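/- arXiv:1207.0451 — 3 statements merged into one kernel-verified Lean document; each statement's English description precedes it below -/
import Mathlib

section
/- Let G be a group with a finite symmetric generating set S, let K > 0, and suppose there is a sequence (ξ_n) of finitely supported probability measures on G such that ‖λ_γ ξ_n − ξ_n‖_{ℓ¹(G)} → 0 as n → ∞ for every γ ∈ G, and such that Trc(ρ_s ξ_n^∨, ξ_n^∨) ≤ K for every s ∈ S and every n (i.e. G is transport amenable). Then for every real p with 1 < p < ∞, the degree-one reduced ℓ^p-cohomology of (G,S) vanishes: for every p-Dirichlet f : G → ℝ and every ε > 0 there exists h ∈ ℓ^p(G) with ‖∇_s(f − h)‖_{ℓ^p(G)} < ε for every s ∈ S. -/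
open Filter Topology

/-- Word length of `g` with respect to the generating set `S`. -/
noncomputable def wordLength {G : Type*} [Group G] (S : Finset G) (g : G) : ℕ :=
  sInf {n : ℕ | ∃ l : List G, l.length = n ∧ (∀ x ∈ l, x ∈ S) ∧ l.prod = g}

/-- Cayley graph distance `d(x,y) = |y * x⁻¹|`. -/
noncomputable def cayleyDist {G : Type*} [Group G] (S : Finset G) (x y : G) : ℝ :=
  (wordLength S (y * x⁻¹) : ℝ)

/-- Partial gradient `∇ₛ f (x) = f (s⁻¹ x) - f x`. -/
def grad {G : Type*} [Group G] (s : G) (f : G → ℝ) : G → ℝ :=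
  fun x => f (s⁻¹ * x) - f x

/-- `f` is `p`-summable. -/
def MemLp' {G : Type*} (p : ℝ) (f : G → ℝ) : Prop :=
  Summable fun x => |f x| ^ p

/-- The `ℓ^p` norm of `f`. -/
noncomputable def lpNorm {G : Type*} (p : ℝ) (f : G → ℝ) : ℝ :=
  (∑' x, |f x| ^ p) ^ (1 / p)

/-- `f` is `p`-Dirichlet: every partial gradient is in `ℓ^p`. -/
def IsDirichlet {G : Type*} [Group G] (S : Finset G) (p : ℝ) (f : G → ℝ) : Prop :=
  ∀ s ∈ S, MemLp' p (grad s f)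

/-- Convolution `(ξ * f)(x) = ∑ ξ γ • f (γ⁻¹ x)`. -/
noncomputable def conv {G : Type*} [Group G] (ξ f : G → ℝ) : G → ℝ :=
  fun x => ∑' γ, ξ γ * f (γ⁻¹ * x)

/-- A finitely supported probability measure on `G`. -/
def IsProbMeasure {G : Type*} (ξ : G → ℝ) : Prop :=
  (∀ x, 0 ≤ ξ x) ∧ (Function.support ξ).Finite ∧ (∑' x, ξ x) = 1

/-- `ξ^∨ (x) = ξ (x⁻¹)`. -/
def invMeasure {G : Type*} [Group G] (ξ : G → ℝ) : G → ℝ := fun x => ξ x⁻¹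

/-- `(ρ_s ξ^∨)(x) = ξ^∨ (x * s)`. -/
def rhoInvMeasure {G : Type*} [Group G] (ξ : G → ℝ) (s : G) : G → ℝ :=
  fun x => ξ (x * s)⁻¹

/-- `m` is a coupling of `ξ` and `φ`. -/
def IsCoupling {G : Type*} (m : G × G → ℝ) (ξ φ : G → ℝ) : Prop :=
  (∀ z, 0 ≤ m z) ∧ (Function.support m).Finite ∧
    (∀ x, (∑' y, m (x, y)) = ξ x) ∧ (∀ y, (∑' x, m (x, y)) = φ y)

/-- The transportation cost between `ξ` and `φ`, for the Cayley distance of `(G,S)`. -/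
noncomputable def Trc {G : Type*} [Group G] (S : Finset G) (ξ φ : G → ℝ) : ℝ :=
  sInf {c : ℝ | ∃ m, IsCoupling m ξ φ ∧ c = ∑' z : G × G, m z * cayleyDist S z.1 z.2}

/-- `G` is transport amenable (with respect to `S`). -/
def TransportAmenable {G : Type*} [Group G] (S : Finset G) : Prop :=
  ∃ K > (0 : ℝ), ∃ ξ : ℕ → G → ℝ,
    (∀ n, IsProbMeasure (ξ n)) ∧
    (∀ γ : G, Tendsto (fun n => ∑' x, |ξ n (γ⁻¹ * x) - ξ n x|) atTop (𝓝 0)) ∧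
    (∀ s ∈ S, ∀ n, Trc S (rhoInvMeasure (ξ n) s) (invMeasure (ξ n)) ≤ K)

/-- `f` is `p`-summable with `ℓ^p` norm at most `C`. -/
def LpBound {ι : Type*} (p : ℝ) (f : ι → ℝ) (C : ℝ) : Prop :=
  MemLp' p f ∧ lpNorm p f ≤ C

section Lp

variable {ι κ : Type*} {p : ℝ}

lemma MemLp'.lpBound {f : ι → ℝ} (hf : MemLp' p f) : LpBound p f (lpNorm p f) :=
  ⟨hf, le_rfl⟩

lemma LpBound.mono {f : ι → ℝ} {C D : ℝ} (hf : LpBound p f C) (h : C ≤ D) : LpBound p f D :=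
  ⟨hf.1, hf.2.trans h⟩

lemma lpNorm_nonneg (f : ι → ℝ) : 0 ≤ lpNorm p f :=
  Real.rpow_nonneg (tsum_nonneg fun _ => Real.rpow_nonneg (abs_nonneg _) _) _

lemma memLp'_of_abs_le (hp : 1 < p) {f g : ι → ℝ} (hg : MemLp' p g)
    (h : ∀ x, |f x| ≤ |g x|) : MemLp' p f :=
  Summable.of_nonneg_of_le (fun _ => Real.rpow_nonneg (abs_nonneg _) _)
    (fun x => Real.rpow_le_rpow (abs_nonneg _) (h x) (by linarith)) hg

lemma LpBound.add (hp : 1 < p) {f g : ι → ℝ} {C D : ℝ} (hf : LpBound p f C)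
    (hg : LpBound p g D) : LpBound p (fun x => f x + g x) (C + D) := by
  obtain ⟨hs, hle⟩ := Real.Lp_add_le_tsum_of_nonneg hp.le (fun x => abs_nonneg (f x))
    (fun x => abs_nonneg (g x)) hf.1 hg.1
  have hpt : ∀ x, |f x + g x| ^ p ≤ (|f x| + |g x|) ^ p := fun x =>
    Real.rpow_le_rpow (abs_nonneg _) (abs_add_le _ _) (by linarith)
  have hsum : MemLp' p (fun x => f x + g x) :=
    Summable.of_nonneg_of_le (fun _ => Real.rpow_nonneg (abs_nonneg _) _) hpt hs
  refine ⟨hsum, le_trans ?_ (hle.trans (add_le_add hf.2 hg.2))⟩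
  exact Real.rpow_le_rpow (tsum_nonneg fun _ => Real.rpow_nonneg (abs_nonneg _) _)
    (Summable.tsum_le_tsum hpt hsum hs) (by positivity)

lemma LpBound.const_mul (hp : 1 < p) {f : ι → ℝ} {C : ℝ} (hf : LpBound p f C) (a : ℝ) :
    LpBound p (fun x => a * f x) (|a| * C) := by
  have hpt : ∀ x, |a * f x| ^ p = |a| ^ p * |f x| ^ p := fun x => by
    rw [abs_mul, Real.mul_rpow (abs_nonneg _) (abs_nonneg _)]
  refine ⟨?_, ?_⟩
  · simpa only [MemLp', hpt] using hf.1.mul_left (|a| ^ p)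
  · simp only [lpNorm, hpt]
    rw [tsum_mul_left, Real.mul_rpow (Real.rpow_nonneg (abs_nonneg _) _)
      (tsum_nonneg fun _ => Real.rpow_nonneg (abs_nonneg _) _), ← Real.rpow_mul (abs_nonneg _),
      mul_one_div_cancel (by linarith), Real.rpow_one]
    exact mul_le_mul_of_nonneg_left hf.2 (abs_nonneg _)

lemma lpBound_zero (hp : 1 < p) : LpBound p (fun _ : ι => (0 : ℝ)) 0 := by
  have h0 : (0 : ℝ) ^ p = 0 := Real.zero_rpow (by linarith)
  have h1 : (0 : ℝ) ^ p⁻¹ = 0 := Real.zero_rpow (inv_ne_zero (by linarith))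
  constructor
  · simp [MemLp', h0, summable_zero]
  · simp [lpNorm, h0, h1]

lemma LpBound.sum (hp : 1 < p) (T : Finset κ) {f : κ → ι → ℝ} {C : κ → ℝ}
    (h : ∀ k ∈ T, LpBound p (f k) (C k)) :
    LpBound p (fun x => ∑ k ∈ T, f k x) (∑ k ∈ T, C k) := by
  classical
  induction T using Finset.induction_on with
  | empty => simpa using lpBound_zero hp
  | insert k T hk ih =>
    simp only [Finset.sum_insert hk]
    exact (h k (Finset.mem_insert_self _ _)).add hp
      (ih fun j hj => h j (Finset.mem_insert_of_mem hj))

lemma LpBound.comp_equiv {f : ι → ℝ} {C : ℝ} (hf : LpBound p f C) (e : κ ≃ ι) :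
    LpBound p (fun x => f (e x)) C := by
  refine ⟨(e.summable_iff (f := fun x => |f x| ^ p)).2 hf.1, ?_⟩
  have := hf.2
  rwa [lpNorm, ← e.tsum_eq] at this

lemma LpBound.tsum_rpow_le (hp : 1 < p) {f : ι → ℝ} {C : ℝ} (hf : LpBound p f C) :
    ∑' x, |f x| ^ p ≤ C ^ p := by
  have h0 : 0 ≤ ∑' x, |f x| ^ p := tsum_nonneg fun _ => Real.rpow_nonneg (abs_nonneg _) _
  have := Real.rpow_le_rpow (lpNorm_nonneg f) hf.2 (by linarith : 0 ≤ p)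
  rwa [lpNorm, ← Real.rpow_mul h0, one_div_mul_cancel (by linarith), Real.rpow_one] at this

lemma tendsto_lpNorm_zero_of_dominated (hp : 1 < p) {f : ι → ℝ} (hf : MemLp' p f)
    {g : ℕ → ι → ℝ} (hle : ∀ n x, |g n x| ≤ |f x|)
    (h0 : ∀ x, Tendsto (fun n => g n x) atTop (𝓝 0)) :
    Tendsto (fun n => lpNorm p (g n)) atTop (𝓝 0) := by
  have hp0 : 0 < p := by linarith
  have key : Tendsto (fun n => ∑' x, |g n x| ^ p) atTop (𝓝 (∑' _ : ι, (0 : ℝ))) := by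
    refine tendsto_tsum_of_dominated_convergence hf (fun x => ?_)
      (Eventually.of_forall fun n x => ?_)
    · simpa [Real.zero_rpow hp0.ne'] using (h0 x).abs.rpow_const (Or.inr hp0.le)
    · rw [Real.norm_of_nonneg (Real.rpow_nonneg (abs_nonneg _) _)]
      exact Real.rpow_le_rpow (abs_nonneg _) (hle n x) hp0.le
  rw [tsum_zero] at key
  have := key.rpow_const (p := 1 / p) (Or.inr (by positivity))
  rwa [Real.zero_rpow (by positivity)] at this

lemma abs_add_rpow_le (hp : 1 < p) (a b : ℝ) :
    |a + b| ^ p ≤ 2 ^ (p - 1) * |a| ^ p + 2 ^ (p - 1) * |b| ^ p := by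
  refine (Real.rpow_le_rpow (abs_nonneg _) (abs_add_le a b) (by linarith)).trans ?_
  rw [← mul_add]
  exact_mod_cast NNReal.rpow_add_le_mul_rpow_add_rpow ‖a‖₊ ‖b‖₊ hp.le

/-- A bounded pointwise null sequence in `ℓ^p` eventually increases the `p`-th power of the norm
of a given function by at most a fixed amount. -/
lemma eventually_tsum_add_rpow_le (hp : 1 < p) {W : ι → ℝ} (hW : MemLp' p W)
    {u : ℕ → ι → ℝ} {M : ℝ} (hu : ∀ n, MemLp' p (u n)) (hM : ∀ n, ∑' x, |u n x| ^ p ≤ M)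
    (h0 : ∀ x, Tendsto (fun n => u n x) atTop (𝓝 0)) :
    ∀ᶠ n in atTop, ∑' x, |W x + u n x| ^ p ≤ ∑' x, |W x| ^ p + (2 ^ (p - 1) * M + 1) := by
  have hp0 : 0 < p := by linarith
  set c : ℝ := 2 ^ (p - 1)
  have hc : 0 ≤ c := by positivity
  let g : ℕ → ι → ℝ := fun n x => max (|W x + u n x| ^ p - c * |u n x| ^ p) 0
  have hgle : ∀ n x, g n x ≤ c * |W x| ^ p := fun n x =>
    max_le (by linarith [abs_add_rpow_le hp (W x) (u n x)]) (by positivity)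
  have hg : Tendsto (fun n => ∑' x, g n x) atTop (𝓝 (∑' x, |W x| ^ p)) := by
    refine tendsto_tsum_of_dominated_convergence (hW.mul_left c) (fun x => ?_)
      (Eventually.of_forall fun n x => ?_)
    · have h1 : Tendsto (fun n => |W x + u n x| ^ p) atTop (𝓝 (|W x| ^ p)) := by
        simpa using ((h0 x).const_add (W x)).abs.rpow_const (Or.inr hp0.le)
      have h2 : Tendsto (fun n => c * |u n x| ^ p) atTop (𝓝 0) := by
        simpa [Real.zero_rpow hp0.ne'] using
          ((h0 x).abs.rpow_const (Or.inr hp0.le)).const_mul c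
      have h3 := (h1.sub h2).max (tendsto_const_nhds (x := (0 : ℝ)))
      rwa [sub_zero, max_eq_left (Real.rpow_nonneg (abs_nonneg _) _)] at h3
    · rw [Real.norm_of_nonneg (le_max_right _ _)]
      exact hgle n x
  filter_upwards [hg.eventually (gt_mem_nhds (lt_add_one _))] with n hn
  have hgs : Summable (g n) :=
    Summable.of_nonneg_of_le (fun _ => le_max_right _ _) (hgle n) (hW.mul_left c)
  have hus : Summable fun x => c * |u n x| ^ p := (hu n).mul_left c
  have hWu : Summable fun x => |W x + u n x| ^ p :=
    (hW.lpBound.add hp (hu n).lpBound).1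
  have h1 : ∑' x, |W x + u n x| ^ p ≤ ∑' x, (g n x + c * |u n x| ^ p) :=
    Summable.tsum_le_tsum
      (fun x => by linarith [le_max_left (|W x + u n x| ^ p - c * |u n x| ^ p) 0])
      hWu (hgs.add hus)
  rw [hgs.tsum_add hus, tsum_mul_left] at h1
  have h2 := mul_le_mul_of_nonneg_left (hM n) hc
  linarith

end Lp

section Truncation

lemma abs_clamp_le {N : ℝ} (hN : 0 ≤ N) (a : ℝ) : |max (-N) (min a N)| ≤ N :=
  abs_le.2 ⟨le_max_left _ _, max_le (by linarith) (min_le_right _ _)⟩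

lemma clamp_eq_self {N a : ℝ} (h : |a| ≤ N) : max (-N) (min a N) = a := by
  rw [abs_le] at h
  rw [min_eq_left h.2, max_eq_right h.1]

lemma abs_clamp_sub_clamp_le (N a b : ℝ) :
    |max (-N) (min a N) - max (-N) (min b N)| ≤ |a - b| :=
  calc _ ≤ |min a N - min b N| := by
        simpa [max_comm] using abs_max_sub_max_le_abs (min a N) (min b N) (-N)
    _ ≤ |a - b| := by simpa using abs_min_sub_min_le_max a N b N

lemma abs_sub_sub_clamp_le {N : ℝ} (hN : 0 ≤ N) (a b : ℝ) :
    |(a - max (-N) (min a N)) - (b - max (-N) (min b N))| ≤ |a - b| := by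
  rcases max_cases (-N) (min a N) with ⟨h1, h1'⟩ | ⟨h1, h1'⟩ <;>
  rcases max_cases (-N) (min b N) with ⟨h2, h2'⟩ | ⟨h2, h2'⟩ <;>
  rcases min_cases a N with ⟨h3, h3'⟩ | ⟨h3, h3'⟩ <;>
  rcases min_cases b N with ⟨h4, h4'⟩ | ⟨h4, h4'⟩ <;>
  rw [h1, h2] <;> (try rw [h3]) <;> (try rw [h4]) <;> rw [abs_le] <;>
  constructor <;> rcases abs_cases (a - b) with ⟨h5, h5'⟩ | ⟨h5, h5'⟩ <;> linarith

end Truncation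

section Group

variable {G : Type*} [Group G] {S : Finset G} {p : ℝ}

lemma exists_list_of_closure_eq_top (hsym : ∀ s ∈ S, s⁻¹ ∈ S)
    (hgen : Subgroup.closure (S : Set G) = ⊤) (g : G) :
    ∃ l : List G, l.length = wordLength S g ∧ (∀ x ∈ l, x ∈ S) ∧ l.prod = g := by
  refine Nat.sInf_mem (s := {n | ∃ l : List G, l.length = n ∧ (∀ x ∈ l, x ∈ S) ∧ l.prod = g}) ?_
  have hg : g ∈ (Subgroup.closure (S : Set G)).toSubmonoid := by rw [hgen]; trivial
  have hS : (S : Set G) ∪ (S : Set G)⁻¹ = S :=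
    Set.union_eq_left.2 fun x hx => by simpa using hsym _ hx
  rw [Subgroup.closure_toSubmonoid, hS] at hg
  obtain ⟨l, hl, hlg⟩ := Submonoid.exists_list_of_mem_closure hg
  exact ⟨l.length, l, rfl, hl, hlg⟩

lemma lpBound_list_prod_mul_sub (hp : 1 < p) (hsym : ∀ s ∈ S, s⁻¹ ∈ S) {f : G → ℝ}
    {D : ℝ} (hf : ∀ s ∈ S, LpBound p (grad s f) D) (l : List G) (hl : ∀ x ∈ l, x ∈ S) :
    LpBound p (fun x => f (l.prod * x) - f x) (l.length * D) := by
  induction l with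
  | nil => simpa using lpBound_zero hp
  | cons s l ih =>
    have h1 := (hf _ (hsym s (hl s List.mem_cons_self))).comp_equiv (Equiv.mulLeft l.prod)
    have h2 := h1.add hp (ih fun x hx => hl x (List.mem_cons_of_mem _ hx))
    convert h2 using 1
    · ext x
      simp [grad, mul_assoc]
    · push_cast [List.length_cons]
      ring

lemma lpBound_mul_sub_mul (hp : 1 < p) (hsym : ∀ s ∈ S, s⁻¹ ∈ S)
    (hgen : Subgroup.closure (S : Set G) = ⊤) {f : G → ℝ} {D : ℝ}
    (hf : ∀ s ∈ S, LpBound p (grad s f) D) (a b : G) :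
    LpBound p (fun x => f (b * x) - f (a * x)) (cayleyDist S a b * D) := by
  obtain ⟨l, hlen, hl, hprod⟩ := exists_list_of_closure_eq_top hsym hgen (b * a⁻¹)
  have h := (lpBound_list_prod_mul_sub hp hsym hf l hl).comp_equiv (Equiv.mulLeft a)
  rw [hlen, hprod] at h
  simpa [cayleyDist, mul_assoc] using h

lemma summable_mul_of_finite_support {ι : Type*} {ξ : ι → ℝ} (h : (Function.support ξ).Finite)
    (g : ι → ℝ) : Summable fun x => ξ x * g x :=
  summable_of_hasFiniteSupport (h.subset (Function.support_mul_subset_left ξ g))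

lemma tsum_mul_eq_sum {ι : Type*} {ξ : ι → ℝ} (h : (Function.support ξ).Finite)
    (g : ι → ℝ) : ∑' x, ξ x * g x = ∑ x ∈ h.toFinset, ξ x * g x :=
  tsum_eq_sum fun x hx => by
    have : ξ x = 0 := by simpa using hx
    simp [this]

lemma memLp'_sub_conv (hp : 1 < p) (hsym : ∀ s ∈ S, s⁻¹ ∈ S)
    (hgen : Subgroup.closure (S : Set G) = ⊤) {f : G → ℝ} {D : ℝ}
    (hf : ∀ s ∈ S, LpBound p (grad s f) D) {ξ : G → ℝ} (hξ : IsProbMeasure ξ) :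
    MemLp' p (fun x => f x - conv ξ f x) := by
  have h := LpBound.sum hp hξ.2.1.toFinset (fun γ _ =>
    (lpBound_mul_sub_mul hp hsym hgen hf γ⁻¹ 1).const_mul hp (ξ γ))
  convert h.1 using 2 with x
  have h1 : f x = ∑' γ, ξ γ * f x := by rw [tsum_mul_right, hξ.2.2, one_mul]
  rw [conv, tsum_mul_eq_sum hξ.2.1 (fun γ => f (γ⁻¹ * x))]
  conv_lhs => rw [h1, tsum_mul_eq_sum hξ.2.1 (fun _ => f x), ← Finset.sum_sub_distrib]
  simp [mul_sub]

lemma conv_inv_mul (ξ f : G → ℝ) (s x : G) :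
    conv ξ f (s⁻¹ * x) = ∑' γ, ξ (s⁻¹ * γ) * f (γ⁻¹ * x) := by
  rw [conv, ← (Equiv.mulLeft s⁻¹).tsum_eq]
  simp [mul_assoc]

lemma abs_grad_conv_le {f ξ : G → ℝ} {B : ℝ} (hB : ∀ x, |f x| ≤ B) (hξ : IsProbMeasure ξ)
    (s x : G) : |grad s (conv ξ f) x| ≤ (∑' y, |ξ (s⁻¹ * y) - ξ y|) * B := by
  have hs1 : (Function.support fun y => ξ (s⁻¹ * y)).Finite :=
    hξ.2.1.preimage (mul_right_injective s⁻¹).injOn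
  have hs : (Function.support fun y => ξ (s⁻¹ * y) - ξ y).Finite :=
    (hs1.union hξ.2.1).subset (Function.support_sub _ _)
  have hsa : Summable fun y => |ξ (s⁻¹ * y) - ξ y| :=
    (summable_of_hasFiniteSupport hs).abs
  have heq : grad s (conv ξ f) x = ∑' y, (ξ (s⁻¹ * y) - ξ y) * f (y⁻¹ * x) := by
    rw [grad, conv_inv_mul, conv, ← Summable.tsum_sub
      (summable_mul_of_finite_support hs1 _) (summable_mul_of_finite_support hξ.2.1 _)]
    simp [sub_mul]
  rw [heq, ← tsum_mul_right]
  have hsm : Summable fun y => ‖(ξ (s⁻¹ * y) - ξ y) * f (y⁻¹ * x)‖ :=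
    (summable_mul_of_finite_support hs (fun y => f (y⁻¹ * x))).abs
  rw [← Real.norm_eq_abs]
  refine (norm_tsum_le_tsum_norm hsm).trans
    (Summable.tsum_le_tsum (fun y => ?_) hsm (hsa.mul_right B))
  rw [Real.norm_eq_abs, abs_mul]
  exact mul_le_mul_of_nonneg_left (hB _) (abs_nonneg _)

lemma conv_eq_tsum_invMeasure (ξ f : G → ℝ) (x : G) :
    conv ξ f x = ∑' b, invMeasure ξ b * f (b * x) := by
  rw [conv, ← (Equiv.inv G).tsum_eq]
  simp [invMeasure]

lemma conv_inv_mul_eq_tsum_rhoInvMeasure (ξ f : G → ℝ) (s x : G) :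
    conv ξ f (s⁻¹ * x) = ∑' a, rhoInvMeasure ξ s a * f (a * x) := by
  rw [conv_eq_tsum_invMeasure, ← (Equiv.mulRight s).tsum_eq]
  simp [invMeasure, rhoInvMeasure, mul_assoc]

lemma IsCoupling.tsum_fst {ι : Type*} {m : ι × ι → ℝ} {ξ φ : ι → ℝ} (hm : IsCoupling m ξ φ)
    (g : ι → ℝ) : ∑' a, ξ a * g a = ∑' z, m z * g z.1 := by
  rw [(summable_mul_of_finite_support hm.2.1 (fun z => g z.1)).tsum_prod]
  simp [tsum_mul_right, hm.2.2.1]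

lemma IsCoupling.tsum_snd {ι : Type*} {m : ι × ι → ℝ} {ξ φ : ι → ℝ} (hm : IsCoupling m ξ φ)
    (g : ι → ℝ) : ∑' b, φ b * g b = ∑' z, m z * g z.2 := by
  have hs := summable_mul_of_finite_support hm.2.1 (fun z => g z.2)
  rw [hs.tsum_prod, ← Summable.tsum_comm (f := fun a b => m (a, b) * g b) hs]
  simp [tsum_mul_right, hm.2.2.2]

lemma isCoupling_prod {ι : Type*} {ξ φ : ι → ℝ} (hξ : IsProbMeasure ξ) (hφ : IsProbMeasure φ) :
    IsCoupling (fun z : ι × ι => ξ z.1 * φ z.2) ξ φ := by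
  refine ⟨fun z => mul_nonneg (hξ.1 _) (hφ.1 _), ?_, fun x => ?_, fun y => ?_⟩
  · refine (hξ.2.1.prod hφ.2.1).subset fun z hz => ?_
    simpa using hz
  · simp [tsum_mul_left, hφ.2.2]
  · simp [tsum_mul_right, hξ.2.2]

lemma IsProbMeasure.comp_equiv {ι κ : Type*} {ξ : ι → ℝ} (h : IsProbMeasure ξ) (e : κ ≃ ι) :
    IsProbMeasure fun x => ξ (e x) :=
  ⟨fun _ => h.1 _, h.2.1.preimage e.injective.injOn, (e.tsum_eq ξ).trans h.2.2⟩

lemma IsProbMeasure.exists_coupling_lt {ξ φ : G → ℝ} (hξ : IsProbMeasure ξ)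
    (hφ : IsProbMeasure φ) {K : ℝ} (h : Trc S ξ φ < K) :
    ∃ m, IsCoupling m ξ φ ∧ ∑' z : G × G, m z * cayleyDist S z.1 z.2 < K := by
  have hne : {c : ℝ | ∃ m, IsCoupling m ξ φ ∧
      c = ∑' z : G × G, m z * cayleyDist S z.1 z.2}.Nonempty :=
    ⟨_, _, isCoupling_prod hξ hφ, rfl⟩
  obtain ⟨c, ⟨m, hm, rfl⟩, hc⟩ := exists_lt_of_csInf_lt hne h
  exact ⟨m, hm, hc⟩

lemma lpBound_grad_conv (hp : 1 < p) (hsym : ∀ s ∈ S, s⁻¹ ∈ S)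
    (hgen : Subgroup.closure (S : Set G) = ⊤) {f : G → ℝ} {D : ℝ} (hD : 0 ≤ D)
    (hf : ∀ s ∈ S, LpBound p (grad s f) D) {ξ : G → ℝ} (hξ : IsProbMeasure ξ) {K : ℝ} {s : G}
    (htrc : Trc S (rhoInvMeasure ξ s) (invMeasure ξ) < K) :
    LpBound p (grad s (conv ξ f)) (K * D) := by
  obtain ⟨m, hm, hmK⟩ := IsProbMeasure.exists_coupling_lt
    (hξ.comp_equiv ((Equiv.mulRight s).trans (Equiv.inv G))) (hξ.comp_equiv (Equiv.inv G)) htrc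
  change IsCoupling m (rhoInvMeasure ξ s) (invMeasure ξ) at hm
  have hcost : ∑ z ∈ hm.2.1.toFinset, |-m z| * (cayleyDist S z.1 z.2 * D) ≤ K * D := by
    rw [tsum_mul_eq_sum hm.2.1] at hmK
    simp only [abs_neg, abs_of_nonneg (hm.1 _), ← mul_assoc]
    rw [← Finset.sum_mul]
    exact mul_le_mul_of_nonneg_right hmK.le hD
  have h := (LpBound.sum hp hm.2.1.toFinset (fun z _ =>
    (lpBound_mul_sub_mul hp hsym hgen hf z.1 z.2).const_mul hp (-m z))).mono hcost
  convert h using 1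
  ext x
  rw [grad, conv_inv_mul_eq_tsum_rhoInvMeasure, conv_eq_tsum_invMeasure,
    hm.tsum_fst (fun a => f (a * x)), hm.tsum_snd (fun a => f (a * x)),
    tsum_mul_eq_sum hm.2.1 (fun z => f (z.1 * x)), tsum_mul_eq_sum hm.2.1 (fun z => f (z.2 * x)),
    ← Finset.sum_sub_distrib]
  exact Finset.sum_congr rfl fun z _ => by ring

/-- The vanishing statement for a bounded function. -/
lemma exists_memLp'_lpNorm_grad_sub_lt_of_bounded (hsym : ∀ s ∈ S, s⁻¹ ∈ S)
    (hgen : Subgroup.closure (S : Set G) = ⊤) {K : ℝ} (hK : 0 < K) {ξ : ℕ → G → ℝ}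
    (hprob : ∀ n, IsProbMeasure (ξ n))
    (hmean : ∀ γ : G, Tendsto (fun n => ∑' x, |ξ n (γ⁻¹ * x) - ξ n x|) atTop (𝓝 0))
    (htrc : ∀ s ∈ S, ∀ n, Trc S (rhoInvMeasure (ξ n) s) (invMeasure (ξ n)) ≤ K)
    (hp : 1 < p) {f : G → ℝ} (hf : IsDirichlet S p f) {B : ℝ} (hB : ∀ x, |f x| ≤ B)
    {ε : ℝ} (hε : 0 < ε) :
    ∃ h : G → ℝ, MemLp' p h ∧ ∀ s ∈ S, LpBound p (grad s (fun x => f x - h x)) ε := by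
  have hp0 : 0 < p := by linarith
  set D := ∑ s ∈ S, lpNorm p (grad s f)
  have hD : 0 ≤ D := Finset.sum_nonneg fun s _ => lpNorm_nonneg _
  have hfD : ∀ s ∈ S, LpBound p (grad s f) D := fun s hs =>
    ⟨hf s hs, Finset.single_le_sum (f := fun s => lpNorm p (grad s f))
      (fun s _ => lpNorm_nonneg _) hs⟩
  have hbd : ∀ n, ∀ s ∈ S, LpBound p (grad s (conv (ξ n) f)) ((K + 1) * D) := fun n s hs =>
    lpBound_grad_conv hp hsym hgen hD hfD (hprob n) ((htrc s hs n).trans_lt (lt_add_one K))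
  have hlim : ∀ s x, Tendsto (fun n => grad s (conv (ξ n) f) x) atTop (𝓝 0) := fun s x =>
    squeeze_zero_norm (fun n => abs_grad_conv_le hB (hprob n) s x)
      (by simpa using (hmean s).mul_const B)
  set M : ℝ := 2 ^ (p - 1) * ((K + 1) * D) ^ p + 1
  have hM : 0 ≤ M := by positivity
  have hstep : ∀ N : ℕ, ∃ h : G → ℝ, MemLp' p h ∧ ∀ s ∈ S,
      MemLp' p (grad s fun x => N * f x - h x) ∧
      ∑' x, |grad s (fun x => N * f x - h x) x| ^ p ≤ N * M := by
    intro N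
    induction N with
    | zero =>
      refine ⟨fun _ => 0, (lpBound_zero hp).1, fun s _ => ?_⟩
      have h0 : grad s (fun x => ((0 : ℕ) : ℝ) * f x - 0) = fun _ => 0 := by
        ext x; simp [grad]
      rw [h0]
      exact ⟨(lpBound_zero hp).1, by simp [Real.zero_rpow hp0.ne']⟩
    | succ N ih =>
      obtain ⟨h, hh, hN⟩ := ih
      have hev : ∀ᶠ n in atTop, ∀ s ∈ S,
          ∑' x, |grad s (fun x => N * f x - h x) x + grad s (conv (ξ n) f) x| ^ p
            ≤ ∑' x, |grad s (fun x => N * f x - h x) x| ^ p + M :=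
        (Filter.eventually_all_finset S).2 fun s hs =>
          eventually_tsum_add_rpow_le hp (hN s hs).1 (fun n => (hbd n s hs).1)
            (fun n => (hbd n s hs).tsum_rpow_le hp) (hlim s)
      obtain ⟨n, hn⟩ := hev.exists
      refine ⟨fun x => h x + (f x - conv (ξ n) f x),
        (hh.lpBound.add hp (memLp'_sub_conv hp hsym hgen hfD (hprob n)).lpBound).1,
        fun s hs => ?_⟩
      have heq : grad s (fun x => ((N + 1 : ℕ) : ℝ) * f x - (h x + (f x - conv (ξ n) f x)))
          = fun x => grad s (fun x => N * f x - h x) x + grad s (conv (ξ n) f) x := by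
        ext x
        simp only [grad]
        push_cast
        ring
      rw [heq]
      refine ⟨((hN s hs).1.lpBound.add hp (hbd n s hs)).1, ?_⟩
      push_cast
      linarith [hn s hs, (hN s hs).2]
  have hev : ∀ᶠ N : ℕ in atTop, M / ε ^ p ≤ (N : ℝ) ^ (p - 1) :=
    ((tendsto_rpow_atTop (by linarith : 0 < p - 1)).comp
      tendsto_natCast_atTop_atTop).eventually_ge_atTop _
  obtain ⟨N, hN, hN0⟩ := (hev.and (eventually_gt_atTop 0)).exists
  have hNr : (0 : ℝ) < N := by exact_mod_cast hN0
  obtain ⟨h, hh, hW⟩ := hstep N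
  refine ⟨fun x => (N : ℝ)⁻¹ * h x, (hh.lpBound.const_mul hp _).1, fun s hs => ?_⟩
  have hWN : LpBound p (grad s fun x => N * f x - h x) (N * ε) := by
    refine ⟨(hW s hs).1, ?_⟩
    have hle : N * M ≤ (N * ε) ^ p := by
      rw [div_le_iff₀ (by positivity)] at hN
      rw [Real.mul_rpow hNr.le hε.le]
      calc N * M ≤ N * ((N : ℝ) ^ (p - 1) * ε ^ p) := mul_le_mul_of_nonneg_left hN hNr.le
        _ = (N : ℝ) ^ p * ε ^ p := by
          rw [← mul_assoc, Real.rpow_sub_one hNr.ne', mul_div_cancel₀ _ hNr.ne']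
    calc lpNorm p (grad s fun x => N * f x - h x) ≤ ((N * ε) ^ p) ^ (1 / p) :=
          Real.rpow_le_rpow (tsum_nonneg fun _ => Real.rpow_nonneg (abs_nonneg _) _)
            ((hW s hs).2.trans hle) (by positivity)
      _ = N * ε := by
          rw [← Real.rpow_mul (by positivity), mul_one_div_cancel hp0.ne', Real.rpow_one]
  convert hWN.const_mul hp (N : ℝ)⁻¹ using 1
  · ext x
    simp only [grad]
    field_simp
  · rw [abs_of_pos (by positivity)]
    field_simp

/-- Truncations of a `p`-Dirichlet function approximate it in the Dirichlet seminorm. -/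
lemma IsDirichlet.exists_bounded_approx (hp : 1 < p) {f : G → ℝ} (hf : IsDirichlet S p f)
    {ε : ℝ} (hε : 0 < ε) :
    ∃ g : G → ℝ, IsDirichlet S p g ∧ (∃ B, ∀ x, |g x| ≤ B) ∧
      ∀ s ∈ S, LpBound p (grad s fun x => f x - g x) ε := by
  let g : ℕ → G → ℝ := fun N x => max (-N) (min (f x) N)
  have hle : ∀ s N x, |grad s (fun x => f x - g N x) x| ≤ |grad s f x| := fun s N x =>
    abs_sub_sub_clamp_le N.cast_nonneg _ _
  have hev : ∀ᶠ N in atTop, ∀ s ∈ S, lpNorm p (grad s fun x => f x - g N x) < ε := by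
    refine (Filter.eventually_all_finset S).2 fun s hs => ?_
    refine (tendsto_lpNorm_zero_of_dominated hp (hf s hs) (hle s) fun x => ?_).eventually
      (gt_mem_nhds hε)
    have hx : ∀ y, ∀ᶠ N : ℕ in atTop, g N y = f y := fun y =>
      (tendsto_natCast_atTop_atTop.eventually_ge_atTop |f y|).mono fun N h => clamp_eq_self h
    refine tendsto_const_nhds.congr' ?_
    filter_upwards [hx x, hx (s⁻¹ * x)] with N h1 h2
    simp [grad, h1, h2]
  obtain ⟨N, hN⟩ := hev.exists
  exact ⟨g N, fun s hs => memLp'_of_abs_le hp (hf s hs) fun x => abs_clamp_sub_clamp_le _ _ _,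
    ⟨N, fun x => abs_clamp_le N.cast_nonneg _⟩,
    fun s hs => ⟨memLp'_of_abs_le hp (hf s hs) (hle s N), (hN s hs).le⟩⟩

end Group


theorem vanishing_of_reduced_lp_cohomology_of_transport_amenable
    {G : Type*} [Group G] (S : Finset G)
    (hsym : ∀ s ∈ S, s⁻¹ ∈ S) (hgen : Subgroup.closure (S : Set G) = ⊤)
    (K : ℝ) (hK : 0 < K) (ξ : ℕ → G → ℝ)
    (hprob : ∀ n, IsProbMeasure (ξ n))
    (hmean : ∀ γ : G, Tendsto (fun n => ∑' x, |ξ n (γ⁻¹ * x) - ξ n x|) atTop (𝓝 0))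
    (htrc : ∀ s ∈ S, ∀ n, Trc S (rhoInvMeasure (ξ n) s) (invMeasure (ξ n)) ≤ K)
    (p : ℝ) (hp : 1 < p) (f : G → ℝ) (hf : IsDirichlet S p f) (ε : ℝ) (hε : 0 < ε) :
    ∃ h : G → ℝ, MemLp' p h ∧ ∀ s ∈ S, lpNorm p (grad s (fun x => f x - h x)) < ε := by
  obtain ⟨g, hg, ⟨B, hB⟩, hfg⟩ := hf.exists_bounded_approx hp (ε := ε / 3) (by positivity)
  obtain ⟨h, hh, hgh⟩ := exists_memLp'_lpNorm_grad_sub_lt_of_bounded hsym hgen hK hprob hmean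
    htrc hp hg hB (ε := ε / 3) (by positivity)
  refine ⟨h, hh, fun s hs => ?_⟩
  have key := ((hfg s hs).add hp (hgh s hs)).2
  have heq : grad s (fun x => f x - h x) =
      fun x => grad s (fun x => f x - g x) x + grad s (fun x => g x - h x) x := by
    ext x
    simp only [grad]
    ring
  rw [heq]
  linarith
end

section
/- Let G be a group with a finite symmetric generating set S, and suppose G has infinitely many finite conjugacy classes, i.e. the set {g ∈ G : the conjugacy class {η g η⁻¹ : η ∈ G} is finite} is infinite. Then for every real p with 1 < p < ∞, the degree-one reduced ℓ^p-cohomology of (G,S) vanishes: for every p-Dirichlet f : G → ℝ and every ε > 0 there exists h ∈ ℓ^p(G) with ‖∇_s(f − h)‖_{ℓ^p(G)} < ε for every s ∈ S. -/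
open Filter Topology

open scoped ENNReal

theorem memLp'_iff_memℓp {α : Type*} {q : ℝ≥0∞} (hq : 0 < q.toReal) {f : α → ℝ} :
    MemLp' q.toReal f ↔ Memℓp f q := by
  rw [memℓp_gen_iff hq]
  rfl

theorem lpNorm_eq_norm {α : Type*} {q : ℝ≥0∞} (hq : 0 < q.toReal) (u : lp (fun _ : α => ℝ) q) :
    lpNorm q.toReal (u : α → ℝ) = ‖u‖ := by
  rw [lp.norm_eq_tsum_rpow hq]
  rfl

theorem MemLp'.comp_mul_left {G : Type*} [Group G] {p : ℝ} {f : G → ℝ} (hf : MemLp' p f) (g : G) :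
    MemLp' p fun x => f (g * x) :=
  (Equiv.mulLeft g).summable_iff.mpr hf

theorem Memℓp.comp_mul_left {G : Type*} [Group G] {q : ℝ≥0∞} (hq : 0 < q.toReal) {f : G → ℝ}
    (hf : Memℓp f q) (g : G) : Memℓp (fun x => f (g * x)) q :=
  (memLp'_iff_memℓp hq).1 (((memLp'_iff_memℓp hq).2 hf).comp_mul_left g)

/-- If the gradients of `f` along a generating set are in `ℓ^q`, all its gradients are. -/
theorem memℓp_grad_of_closure {G : Type*} [Group G] {S : Set G} (hgen : Subgroup.closure S = ⊤)
    {q : ℝ≥0∞} (hq : 0 < q.toReal) {f : G → ℝ} (hf : ∀ s ∈ S, Memℓp (grad s f) q) (g : G) :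
    Memℓp (grad g f) q := by
  have hg : g ∈ Subgroup.closure S := hgen ▸ Subgroup.mem_top g
  induction hg using Subgroup.closure_induction with
  | mem s hs => exact hf s hs
  | one =>
    have h : grad (1 : G) f = 0 := by
      funext x
      simp [grad]
    exact h ▸ zero_memℓp
  | mul a b _ _ ha hb =>
    convert (hb.comp_mul_left hq a⁻¹).add ha using 1
    funext x
    simp [grad, mul_assoc]
  | inv a _ ha =>
    convert (ha.comp_mul_left hq a).neg using 1
    funext x
    simp [grad]

section Averaging

variable {G : Type*} [Group G] {q : ℝ≥0∞}

/-- Left translation by `g` on `ℓ^q(G)`. -/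
def leftTranslate (hq : 0 < q.toReal) (g : G) :
    lp (fun _ : G => ℝ) q →ₗ[ℝ] lp (fun _ : G => ℝ) q where
  toFun u := ⟨fun x => u (g⁻¹ * x), (lp.memℓp u).comp_mul_left hq g⁻¹⟩
  map_add' _ _ := rfl
  map_smul' _ _ := rfl

@[simp]
theorem leftTranslate_apply (hq : 0 < q.toReal) (g : G) (u : lp (fun _ : G => ℝ) q) (x : G) :
    leftTranslate hq g u x = u (g⁻¹ * x) :=
  rfl

theorem norm_leftTranslate (hq : 0 < q.toReal) (g : G) (u : lp (fun _ : G => ℝ) q) :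
    ‖leftTranslate hq g u‖ = ‖u‖ := by
  rw [lp.norm_eq_tsum_rpow hq, lp.norm_eq_tsum_rpow hq]
  congr 1
  exact (Equiv.mulLeft g⁻¹).tsum_eq fun x => ‖u x‖ ^ q.toReal

theorem leftTranslate_single [DecidableEq G] (hq : 0 < q.toReal) (g y : G) (a : ℝ) :
    leftTranslate hq g (lp.single q y a) = lp.single q (g * y) a := by
  ext x
  simp [Pi.single_apply, inv_mul_eq_iff_eq_mul]

/-- The mean of the left translates of an `ℓ^q` function over a finite set. -/
noncomputable def translateMean (hq : 0 < q.toReal) (K : Finset G) :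
    lp (fun _ : G => ℝ) q →ₗ[ℝ] lp (fun _ : G => ℝ) q :=
  (K.card : ℝ)⁻¹ • ∑ g ∈ K, leftTranslate hq g

theorem translateMean_eq (hq : 0 < q.toReal) (K : Finset G) (u : lp (fun _ : G => ℝ) q) :
    translateMean hq K u = (K.card : ℝ)⁻¹ • ∑ g ∈ K, leftTranslate hq g u := by
  simp [translateMean]

theorem translateMean_apply (hq : 0 < q.toReal) (K : Finset G) (u : lp (fun _ : G => ℝ) q)
    (x : G) : translateMean hq K u x = (K.card : ℝ)⁻¹ * ∑ g ∈ K, u (g⁻¹ * x) := by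
  rw [translateMean_eq, lp.coeFn_smul, lp.coeFn_sum]
  simp

variable [Fact (1 ≤ q)]

theorem norm_translateMean_le (hq : 0 < q.toReal) (K : Finset G) (u : lp (fun _ : G => ℝ) q) :
    ‖translateMean hq K u‖ ≤ ‖u‖ := by
  rw [translateMean_eq, norm_smul, norm_inv, Real.norm_natCast]
  have h : ‖∑ g ∈ K, leftTranslate hq g u‖ ≤ K.card * ‖u‖ := by
    simpa [norm_leftTranslate] using norm_sum_le K fun g => leftTranslate hq g u
  rcases K.card.eq_zero_or_pos with h0 | h0
  · simp [h0]
  · rw [inv_mul_le_iff₀ (by exact_mod_cast h0)]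
    exact h

theorem norm_translateMean_single [DecidableEq G] (hq : 0 < q.toReal) {K : Finset G}
    (hK : 0 < K.card) (y : G) (a : ℝ) :
    ‖translateMean hq K (lp.single q y a)‖ =
      (K.card : ℝ) ^ (-(1 - q.toReal⁻¹)) * ‖a‖ := by
  have hn : (0 : ℝ) < K.card := by exact_mod_cast hK
  have h : ‖∑ g ∈ K, leftTranslate hq g (lp.single q y a)‖ ^ q.toReal =
      K.card * ‖a‖ ^ q.toReal := by
    simpa [leftTranslate_single] using
      lp.norm_sum_single (E := fun _ : G => ℝ) hq (fun _ => a) (K.map (mulRightEmbedding y))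
  have h' : ‖∑ g ∈ K, leftTranslate hq g (lp.single q y a)‖ =
      (K.card : ℝ) ^ q.toReal⁻¹ * ‖a‖ := by
    rw [← Real.rpow_rpow_inv (norm_nonneg (∑ g ∈ K, _)) hq.ne', h,
      Real.mul_rpow hn.le (by positivity), Real.rpow_rpow_inv (norm_nonneg a) hq.ne']
  rw [translateMean_eq, norm_smul, norm_inv, Real.norm_natCast, h', ← mul_assoc, neg_sub,
    Real.rpow_sub_one hn.ne', div_eq_inv_mul]

/-- Means of translates over larger and larger finite sets tend to zero in `ℓ^q`, `1 < q < ∞`. -/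
theorem tendsto_translateMean (hq : 0 < q.toReal) (hq1 : 1 < q.toReal)
    (u : lp (fun _ : G => ℝ) q) :
    Tendsto (fun K : Finset G => translateMean hq K u) (comap Finset.card atTop) (𝓝 0) := by
  classical
  have hsingle (y : G) (a : ℝ) : Tendsto (fun K : Finset G => translateMean hq K (lp.single q y a))
      (comap Finset.card atTop) (𝓝 0) := by
    rw [tendsto_zero_iff_norm_tendsto_zero]
    have h : Tendsto (fun K : Finset G => (K.card : ℝ) ^ (-(1 - q.toReal⁻¹)) * ‖a‖)
        (comap Finset.card atTop) (𝓝 0) := by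
      simpa using ((tendsto_rpow_neg_atTop (sub_pos.2 (inv_lt_one_of_one_lt₀ hq1))).comp
        (tendsto_natCast_atTop_atTop.comp tendsto_comap)).mul_const ‖a‖
    refine h.congr' ?_
    filter_upwards [tendsto_comap.eventually (eventually_gt_atTop 0)] with K hK
    exact (norm_translateMean_single hq hK y a).symm
  rw [Metric.tendsto_nhds]
  intro ε hε
  have hq_top : q ≠ ⊤ := fun h => by simp [h] at hq
  obtain ⟨F, hF⟩ :=
    ((Metric.tendsto_nhds.1 (lp.hasSum_single hq_top u)) (ε / 2) (half_pos hε)).exists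
  have hsum : Tendsto (fun K : Finset G => translateMean hq K (∑ i ∈ F, lp.single q i (u i)))
      (comap Finset.card atTop) (𝓝 0) := by
    simpa only [map_sum, Finset.sum_const_zero] using
      tendsto_finsetSum F fun i _ => hsingle i (u i)
  filter_upwards [Metric.tendsto_nhds.1 hsum (ε / 2) (half_pos hε)] with K hK
  rw [dist_zero_right] at hK ⊢
  rw [dist_comm, dist_eq_norm] at hF
  calc ‖translateMean hq K u‖
      = ‖translateMean hq K (u - ∑ i ∈ F, lp.single q i (u i)) +
          translateMean hq K (∑ i ∈ F, lp.single q i (u i))‖ := by rw [← map_add, sub_add_cancel]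
    _ ≤ ‖u - ∑ i ∈ F, lp.single q i (u i)‖ +
          ‖translateMean hq K (∑ i ∈ F, lp.single q i (u i))‖ :=
        (norm_add_le _ _).trans (add_le_add_left (norm_translateMean_le hq K _) _)
    _ < ε := by linarith

end Averaging

/-- A group with infinitely many finite conjugacy classes has arbitrarily large finite
conjugation-invariant subsets. -/
theorem exists_conj_invariant_finset {G : Type*} [Group G]
    (hicc : {g : G | {h : G | ∃ η : G, h = η * g * η⁻¹}.Finite}.Infinite) (N : ℕ) :
    ∃ K : Finset G, N ≤ K.card ∧ ∀ s, ∀ c ∈ K, s * c * s⁻¹ ∈ K := by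
  obtain ⟨T, hT, rfl⟩ := hicc.exists_subset_card_eq N
  have hfin : (⋃ g ∈ T, {h : G | ∃ η : G, h = η * g * η⁻¹}).Finite :=
    T.finite_toSet.biUnion fun g hg => hT hg
  refine ⟨hfin.toFinset, Finset.card_le_card fun g hg => ?_, fun s c hc => ?_⟩
  · simp only [Set.Finite.mem_toFinset, Set.mem_iUnion]
    exact ⟨g, hg, 1, by simp⟩
  · simp only [Set.Finite.mem_toFinset, Set.mem_iUnion] at hc ⊢
    obtain ⟨g, hg, η, rfl⟩ := hc
    exact ⟨g, hg, s * η, by group⟩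

theorem vanishing_of_reduced_lp_cohomology_of_infinitely_many_finite_conjugacy_classes
    {G : Type*} [Group G] (S : Finset G)
    (hsym : ∀ s ∈ S, s⁻¹ ∈ S) (hgen : Subgroup.closure (S : Set G) = ⊤)
    (hicc : {g : G | {h : G | ∃ η : G, h = η * g * η⁻¹}.Finite}.Infinite)
    (p : ℝ) (hp : 1 < p) (f : G → ℝ) (hf : IsDirichlet S p f) (ε : ℝ) (hε : 0 < ε) :
    ∃ h : G → ℝ, MemLp' p h ∧ ∀ s ∈ S, lpNorm p (grad s (fun x => f x - h x)) < ε := by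
  have hp0 : 0 < p := one_pos.trans hp
  obtain ⟨q, rfl⟩ : ∃ q : ℝ≥0∞, p = q.toReal :=
    ⟨ENNReal.ofReal p, (ENNReal.toReal_ofReal hp0.le).symm⟩
  have : Fact (1 ≤ q) := ⟨by
    have hq_top : q ≠ ⊤ := fun h => by simp [h] at hp0
    simpa using (ENNReal.toReal_le_toReal ENNReal.one_ne_top hq_top).1 (by simpa using hp.le)⟩
  have hgrad := memℓp_grad_of_closure hgen hp0 fun s hs => (memLp'_iff_memℓp hp0).1 (hf s hs)
  let u (g : G) : lp (fun _ : G => ℝ) q := ⟨grad g f, hgrad g⟩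
  have hev : ∀ᶠ K : Finset G in comap Finset.card atTop,
      ∀ s ∈ S, ‖translateMean hp0 K (u s)‖ < ε := by
    rw [Finset.eventually_all]
    intro s _
    simpa using Metric.tendsto_nhds.1 (tendsto_translateMean hp0 hp (u s)) ε hε
  obtain ⟨N, hN⟩ := eventually_atTop.1 (eventually_comap.1 hev)
  obtain ⟨K, hK, hconj⟩ := exists_conj_invariant_finset hicc (N + 1)
  have hcard : (K.card : ℝ) ≠ 0 := by
    exact_mod_cast (N.succ_pos.trans_le hK).ne'
  let h : lp (fun _ : G => ℝ) q := -((K.card : ℝ)⁻¹ • ∑ c ∈ K, u c)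
  have hmean (x : G) : f x - h x = (K.card : ℝ)⁻¹ * ∑ c ∈ K, f (c⁻¹ * x) := by
    simp only [h, u, lp.coeFn_neg, lp.coeFn_smul, lp.coeFn_sum, Pi.neg_apply, Pi.smul_apply,
      Finset.sum_apply, smul_eq_mul, grad, Finset.sum_sub_distrib, Finset.sum_const, nsmul_eq_mul]
    field_simp
    ring
  refine ⟨h, (memLp'_iff_memℓp hp0).2 (lp.memℓp h), fun s hs => ?_⟩
  have hsum (x : G) : ∑ c ∈ K, f (c⁻¹ * (s⁻¹ * x)) = ∑ c ∈ K, f (s⁻¹ * (c⁻¹ * x)) := by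
    refine Finset.sum_bij' (fun c _ => s * c * s⁻¹) (fun c _ => s⁻¹ * c * s) (hconj s)
      (fun c hc => by simpa using hconj s⁻¹ c hc) ?_ ?_ ?_
    · intros; group
    · intros; group
    · intro c _
      congr 1
      group
  have heq : grad s (fun x => f x - h x) = translateMean hp0 K (u s) := by
    funext x
    rw [translateMean_apply]
    simp only [grad, hmean, hsum, u, Finset.sum_sub_distrib, mul_sub]
  rw [heq, lpNorm_eq_norm hp0]
  exact hN K.card (by omega) K rfl s hs
end

section
/- Let G be a group with a finite symmetric generating set S and let 1 < p < ∞. Suppose that for every bounded p-Dirichlet function f : G → ℝ (i.e. f ∈ ℓ^∞(G) with ∇_s f ∈ ℓ^p(G) for all s ∈ S) and every ε > 0 there exists h ∈ ℓ^p(G) with ‖∇_s(f − h)‖_{ℓ^p(G)} < ε for all s ∈ S. Then the same conclusion holds for every p-Dirichlet f : G → ℝ (not necessarily bounded); that is, the degree-one reduced ℓ^p-cohomology of (G,S) vanishes. -/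
open Filter Topology

/-- Minkowski's inequality for `MemLp'` and `lpNorm`. -/
theorem MemLp'.add_and_lpNorm_add_le {G : Type*} {p : ℝ} (hp : 1 ≤ p) {u v : G → ℝ}
    (hu : MemLp' p u) (hv : MemLp' p v) :
    MemLp' p (fun x => u x + v x) ∧
      lpNorm p (fun x => u x + v x) ≤ lpNorm p u + lpNorm p v := by
  have hp0 : 0 ≤ p := by linarith
  obtain ⟨hsum, hle⟩ := Real.Lp_add_le_tsum_of_nonneg hp (fun x => abs_nonneg (u x))
    (fun x => abs_nonneg (v x)) hu hv
  have hpt : ∀ x, |u x + v x| ^ p ≤ (|u x| + |v x|) ^ p := fun x =>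
    Real.rpow_le_rpow (abs_nonneg _) (abs_add_le _ _) hp0
  have huv : Summable fun x => |u x + v x| ^ p :=
    hsum.of_nonneg_of_le (fun x => by positivity) hpt
  refine ⟨huv, le_trans ?_ hle⟩
  exact Real.rpow_le_rpow (tsum_nonneg fun x => by positivity)
    (huv.tsum_le_tsum hpt hsum) (by positivity)

theorem MemLp'.of_abs_le {G : Type*} {p : ℝ} (hp : 0 ≤ p) {u v : G → ℝ}
    (hv : MemLp' p v) (h : ∀ x, |u x| ≤ |v x|) : MemLp' p u :=
  Summable.of_nonneg_of_le (fun _ => by positivity)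
    (fun x => Real.rpow_le_rpow (abs_nonneg _) (h x) hp) hv

theorem MemLp'.neg {G : Type*} {p : ℝ} {u : G → ℝ} (hu : MemLp' p u) :
    MemLp' p (fun x => -u x) := by
  simpa only [MemLp', abs_neg] using hu

theorem MemLp'.translate_sub {G : Type*} [Group G] {p : ℝ} (hp : 1 ≤ p) {h : G → ℝ}
    (hh : MemLp' p h) (s : G) : MemLp' p fun x => h (s⁻¹ * x) - h x := by
  have ht : MemLp' p fun x => h (s⁻¹ * x) := (Equiv.mulLeft s⁻¹).summable_iff.mpr hh
  simpa only [sub_eq_add_neg] using (ht.add_and_lpNorm_add_le hp hh.neg).1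

/-- Truncation of a real number to the interval `[-T, T]`. -/
def truncate (T u : ℝ) : ℝ := max (-T) (min u T)

theorem abs_truncate_le {T : ℝ} (hT : 0 ≤ T) (u : ℝ) : |truncate T u| ≤ T :=
  abs_le.mpr ⟨le_max_left _ _, max_le (by linarith) (min_le_right _ _)⟩

theorem truncate_of_abs_le {T u : ℝ} (h : |u| ≤ T) : truncate T u = u := by
  rw [truncate, min_eq_left (abs_le.mp h).2, max_eq_right (abs_le.mp h).1]

theorem truncate_sub_truncate_mem {T u v : ℝ} (h : u ≤ v) :
    0 ≤ truncate T v - truncate T u ∧ truncate T v - truncate T u ≤ v - u := by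
  unfold truncate
  constructor
  · exact sub_nonneg.mpr (max_le_max le_rfl (min_le_min h le_rfl))
  · have : max (-T) (min v T) ≤ max (-T) (min u T) + (v - u) := by
      rcases max_cases (-T) (min v T) with h1 | h1 <;>
      rcases max_cases (-T) (min u T) with h2 | h2 <;>
      rcases min_cases v T with h3 | h3 <;>
      rcases min_cases u T with h4 | h4 <;> linarith
    linarith

theorem abs_truncate_sub_truncate_le (T u v : ℝ) : |truncate T u - truncate T v| ≤ |u - v| := by
  rcases le_total u v with h | h
  · obtain ⟨h0, h1⟩ := truncate_sub_truncate_mem (T := T) h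
    rw [abs_sub_comm, abs_sub_comm u, abs_of_nonneg h0, abs_of_nonneg (sub_nonneg.mpr h)]
    exact h1
  · obtain ⟨h0, h1⟩ := truncate_sub_truncate_mem (T := T) h
    rw [abs_of_nonneg h0, abs_of_nonneg (sub_nonneg.mpr h)]
    exact h1

theorem abs_sub_truncate_sub_le (T u v : ℝ) :
    |(u - truncate T u) - (v - truncate T v)| ≤ |u - v| := by
  rcases le_total u v with h | h
  · obtain ⟨h0, h1⟩ := truncate_sub_truncate_mem (T := T) h
    rw [abs_sub_comm u, abs_of_nonneg (sub_nonneg.mpr h), abs_le]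
    constructor <;> linarith
  · obtain ⟨h0, h1⟩ := truncate_sub_truncate_mem (T := T) h
    rw [abs_of_nonneg (sub_nonneg.mpr h), abs_le]
    constructor <;> linarith

theorem tendsto_lpNorm_grad_sub_truncate {G : Type*} [Group G] {p : ℝ} (hp : 0 < p) {f : G → ℝ}
    {s : G} (hf : MemLp' p (grad s f)) :
    Tendsto (fun T : ℝ => lpNorm p (grad s fun x => f x - truncate T (f x))) atTop (𝓝 0) := by
  have key : Tendsto (fun T : ℝ => ∑' x, |grad s (fun x => f x - truncate T (f x)) x| ^ p) atTop
      (𝓝 (∑' _ : G, (0 : ℝ))) := by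
    refine tendsto_tsum_of_dominated_convergence hf (fun x => ?_) (Eventually.of_forall ?_)
    · refine tendsto_const_nhds.congr' ?_
      filter_upwards [eventually_ge_atTop |f (s⁻¹ * x)|, eventually_ge_atTop |f x|] with T h1 h2
      simp [grad, truncate_of_abs_le h1, truncate_of_abs_le h2, hp.ne']
    · intro T x
      rw [Real.norm_of_nonneg (by positivity)]
      exact Real.rpow_le_rpow (abs_nonneg _) (abs_sub_truncate_sub_le T _ _) hp.le
  rw [tsum_zero] at key
  have := key.rpow_const (p := 1 / p) (Or.inr (by positivity))
  rwa [Real.zero_rpow (by positivity)] at this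

theorem vanishing_on_bounded_dirichlet_implies_vanishing
    {G : Type*} [Group G] (S : Finset G)
    (hsym : ∀ s ∈ S, s⁻¹ ∈ S) (hgen : Subgroup.closure (S : Set G) = ⊤)
    (p : ℝ) (hp : 1 < p)
    (hbdd : ∀ f : G → ℝ, (∃ C : ℝ, ∀ x, |f x| ≤ C) → IsDirichlet S p f →
      ∀ ε > (0 : ℝ), ∃ h : G → ℝ, MemLp' p h ∧
        ∀ s ∈ S, lpNorm p (grad s (fun x => f x - h x)) < ε)
    (f : G → ℝ) (hf : IsDirichlet S p f) (ε : ℝ) (hε : 0 < ε) :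
    ∃ h : G → ℝ, MemLp' p h ∧ ∀ s ∈ S, lpNorm p (grad s (fun x => f x - h x)) < ε := by
  have hp0 : 0 < p := by linarith
  obtain ⟨T, hTs, hT⟩ : ∃ T : ℝ,
      (∀ s ∈ S, lpNorm p (grad s fun x => f x - truncate T (f x)) < ε / 2) ∧ 0 ≤ T :=
    (((S.eventually_all).mpr fun s hs =>
      (tendsto_lpNorm_grad_sub_truncate hp0 (hf s hs)).eventually_lt_const (half_pos hε)).and
      (eventually_ge_atTop 0)).exists
  have htr : IsDirichlet S p fun x => truncate T (f x) := fun s hs =>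
    (hf s hs).of_abs_le hp0.le fun x => abs_truncate_sub_truncate_le T _ _
  obtain ⟨h, hh, hlt⟩ := hbdd (fun x => truncate T (f x))
    ⟨T, fun x => abs_truncate_le hT _⟩ htr (ε / 2) (half_pos hε)
  refine ⟨h, hh, fun s hs => ?_⟩
  have hu : MemLp' p (grad s fun x => f x - truncate T (f x)) :=
    (hf s hs).of_abs_le hp0.le fun x => abs_sub_truncate_sub_le T _ _
  have hv : MemLp' p (grad s fun x => truncate T (f x) - h x) := by
    convert ((htr s hs).add_and_lpNorm_add_le hp.le (hh.translate_sub hp.le s).neg).1 using 2 with x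
    simp only [grad]
    ring
  have hsplit : grad s (fun x => f x - h x) = fun x =>
      grad s (fun x => f x - truncate T (f x)) x + grad s (fun x => truncate T (f x) - h x) x := by
    funext x
    simp only [grad]
    ring
  rw [hsplit]
  linarith [(hu.add_and_lpNorm_add_le hp.le hv).2, hTs s hs, hlt s hs]
end
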